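/- arXiv:2208.05664 — 3 statements merged into one kernel-verified Lean document; each statement's English description precedes it below -/
import Mathlib

section
/- Let q be a prime power, m ≥ 2, r > 1 a divisor of q-1. The dual code C'(q,m,r,1)^⊥ of the λ-constacyclic code C'(q,m,r,1) has dimension Σ_{i=1}^{1} binom(m,i)(q-1)^i / r = m and minimum distance at least q^{m-1}. More generally, for 1 ≤ ℓ ≤ m-1, dim C'(q,m,r,ℓ)^⊥ = (Σ_{i=1}^{ℓ} binom(m,i)(q-1)^i)/r and d(C'(q,m,r,ℓ)^⊥) ≥ q^{m-ℓ}. -/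
/-- The `λ`-constacyclic code of length `n` over `F` with defining set `D`:
codewords are coefficient vectors `c : Fin n → F` such that `∑ t, c t • β^(i·t) = 0`
for every `i ∈ D`, i.e. the polynomial `c(x)` vanishes at `β^i` for all `i ∈ D`. -/
noncomputable def constaCode {F E : Type*} [Field F] [Field E] [Algebra F E]
    (β : E) (D : Finset ℕ) (n : ℕ) : Submodule F (Fin n → F) :=
  ⨅ i ∈ D, LinearMap.ker
    (∑ t : Fin n, (β ^ (i * (t : ℕ))) •
      ((Algebra.linearMap F E).comp (LinearMap.proj t : (Fin n → F) →ₗ[F] F)))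

/-- The dual code: all vectors orthogonal (w.r.t. the standard inner product)
to every codeword of `C`. -/
noncomputable def dualCode {F : Type*} [Field F] {n : ℕ}
    (C : Submodule F (Fin n → F)) : Submodule F (Fin n → F) :=
  ⨅ c ∈ C, LinearMap.ker
    (∑ t : Fin n, c t • (LinearMap.proj t : (Fin n → F) →ₗ[F] F))

def qwt (q i : ℕ) : ℕ := ((Nat.digits q i).filter (· ≠ 0)).length

lemma qwt_zero (q : ℕ) : qwt q 0 = 0 := by simp [qwt]

lemma qwt_add {q : ℕ} (hq : 1 < q) (d i : ℕ) (hd : d < q) :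
    qwt q (d + q * i) = (if d = 0 then 0 else 1) + qwt q i := by
  by_cases h : d ≠ 0 ∨ i ≠ 0
  · unfold qwt
    rw [Nat.digits_add q hq d i hd h, List.filter_cons]
    by_cases h0 : d = 0 <;> simp [h0, add_comm]
  · push Not at h
    obtain ⟨rfl, rfl⟩ := h
    simp [qwt]

lemma qwt_div {q : ℕ} (hq : 1 < q) (i : ℕ) :
    qwt q i = (if i % q = 0 then 0 else 1) + qwt q (i / q) := by
  conv_lhs => rw [← Nat.mod_add_div i q]
  exact qwt_add hq _ _ (Nat.mod_lt _ (by omega))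

lemma qwt_pos {q : ℕ} (hq : 1 < q) : ∀ i : ℕ, i ≠ 0 → qwt q i ≠ 0 := by
  intro i
  induction i using Nat.strong_induction_on with
  | _ i ih =>
    intro hi
    rw [qwt_div hq]
    by_cases h : i % q = 0
    · have h1 : i / q ≠ 0 := by
        intro h2
        have := Nat.mod_add_div i q
        rw [h, h2] at this; simp at this; omega
      have := ih (i / q) (Nat.div_lt_self (by omega) hq) h1
      omega
    · simp [h]

lemma qwt_split {q : ℕ} (hq : 1 < q) (k : ℕ) : ∀ a b : ℕ, b < q ^ k →
    qwt q (b + q ^ k * a) = qwt q b + qwt q a := by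
  induction k with
  | zero => intro a b hb; simp at hb; subst hb; simp [qwt_zero]
  | succ k ih =>
    intro a b hb
    have hlt : b / q < q ^ k := by
      apply Nat.div_lt_of_lt_mul; rw [pow_succ'] at hb; exact hb
    have e : b + q ^ (k+1) * a = b % q + q * (b / q + q ^ k * a) := by
      conv_lhs => rw [← Nat.mod_add_div b q]
      ring
    rw [e, qwt_add hq _ _ (Nat.mod_lt _ (by omega)), ih a _ hlt, qwt_div hq b]
    ring

lemma qwt_lt_bound {q : ℕ} (hq : 1 < q) (l : ℕ) : ∀ a : ℕ, a < q ^ l → qwt q a < l →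
    a + q ≤ q ^ l := by
  induction l with
  | zero => intro a _ h; omega
  | succ l ih =>
    intro a ha hw
    have hlt : a / q < q ^ l := by
      apply Nat.div_lt_of_lt_mul; rw [pow_succ'] at ha; exact ha
    have e := Nat.mod_add_div a q
    have hm := Nat.mod_lt a (show q > 0 by omega)
    rw [qwt_div hq] at hw
    rw [pow_succ']
    by_cases h : a % q = 0
    · have : q * (a / q + 1) ≤ q * q ^ l := Nat.mul_le_mul_left _ hlt
      rw [mul_add] at this; omega
    · simp [h] at hw
      have := ih (a / q) hlt (by omega)
      have : q * (a / q + q) ≤ q * q ^ l := Nat.mul_le_mul_left _ this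
      rw [mul_add] at this
      have : 2 * q ≤ q * q := Nat.mul_le_mul_right _ hq
      omega

lemma qpow_mod {q r : ℕ} (hq : 1 < q) (hrq : r ∣ q - 1) (l : ℕ) : q ^ l ≡ 1 [MOD r] := by
  have : q ≡ 1 [MOD r] := ((Nat.modEq_iff_dvd' hq.le).2 hrq).symm
  simpa using this.pow l

lemma deg_bound {q m r l : ℕ} (hq : 1 < q) (hr : 1 < r) (hrq : r ∣ q - 1) (hl : l ≤ m)
    (i : ℕ) (hi : i < q ^ m) (hw : qwt q i ≤ l) (hir : i % r = 1) :
    i + r * q ^ (m - l) ≤ q ^ m := by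
  set Q := q ^ (m - l) with hQ
  have hQ0 : 0 < Q := by positivity
  have hQm : q ^ m = Q * q ^ l := by rw [hQ, ← pow_add]; congr 1; omega
  have e := Nat.mod_add_div i Q
  have hb := Nat.mod_lt i hQ0
  set a := i / Q with ha
  have hal : a < q ^ l := by
    apply Nat.div_lt_of_lt_mul; rw [← hQm]; exact hi
  have hrq' : r ≤ q - 1 := Nat.le_of_dvd (by omega) hrq
  have hsp := qwt_split hq (m - l) a (i % Q) hb
  rw [← hQ, e] at hsp
  by_cases h : i % Q = 0
  · have h1 : a ≡ 1 [MOD r] := by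
      have h2 : Q * a ≡ 1 * a [MOD r] := (qpow_mod hq hrq (m-l)).mul_right a
      have h3 : i % r = Q * a % r := by rw [← e, h]; simp
      have : i ≡ 1 [MOD r] := by unfold Nat.ModEq; rw [hir, Nat.mod_eq_of_lt hr]
      have h4 : i = Q * a := by omega
      rw [h4] at this
      simpa using h2.symm.trans this
    have h2 : a ≡ q ^ l [MOD r] := h1.trans (qpow_mod hq hrq l).symm
    have h3 := (Nat.modEq_iff_dvd' hal.le).1 h2
    have h4 := Nat.le_of_dvd (by omega) h3
    have h5 : a + r ≤ q ^ l := by omega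
    have := Nat.mul_le_mul_left Q h5
    rw [hQm]; nlinarith
  · have := qwt_pos hq _ h
    have h5 := qwt_lt_bound hq l a hal (by omega)
    have := Nat.mul_le_mul_left Q h5
    have h6 : Q * (r + 1) ≤ Q * q := Nat.mul_le_mul_left Q (by omega)
    rw [hQm]; nlinarith

lemma qwt_top {q : ℕ} (hq : 1 < q) (m : ℕ) : qwt q (q ^ m - 1) = m := by
  induction m with
  | zero => simp [qwt_zero]
  | succ m ih =>
    have : q ^ (m+1) - 1 = (q - 1) + q * (q ^ m - 1) := by
      have : 0 < q ^ m := by positivity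
      have h2 : q * 1 ≤ q * q ^ m := Nat.mul_le_mul_left q this
      rw [pow_succ', Nat.mul_sub]; omega
    rw [this, qwt_add hq _ _ (by omega), ih, if_neg (by omega)]; ring

/-- rotation -/
lemma rot {q m r l : ℕ} (hq : 1 < q) (hr : 1 < r) (hrq : r ∣ q - 1) (hl : l < m)
    (i : ℕ) (hi : i < q ^ m - 1) (hw1 : 1 ≤ qwt q i) (hw : qwt q i ≤ l) (hir : i % r = 1) :
    ∃ j, j < q ^ m - 1 ∧ 1 ≤ qwt q j ∧ qwt q j ≤ l ∧ j % r = 1 ∧ q * i ≡ j [MOD (q ^ m - 1)] := by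
  obtain ⟨m, rfl⟩ : ∃ k, m = k + 1 := ⟨m - 1, by omega⟩
  have hQ0 : 0 < q ^ m := by positivity
  have e := Nat.mod_add_div i (q ^ m)
  have hb := Nat.mod_lt i hQ0
  set a := i / q ^ m with ha
  set b := i % q ^ m with hbb
  have haq : a < q := by
    apply Nat.div_lt_of_lt_mul; rw [← pow_succ]; omega
  have hsp := qwt_split hq m a b hb
  rw [e] at hsp
  have hqa : qwt q a = if a = 0 then 0 else 1 := by
    have := qwt_add hq a 0 haq
    simpa [qwt_zero] using this
  have hj := qwt_add hq a b haq
  have hwj : qwt q (a + q * b) = qwt q i := by omega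
  have hlt : a + q * b < q ^ (m+1) := by
    have : q * (b + 1) ≤ q * q ^ m := Nat.mul_le_mul_left q hb
    rw [pow_succ']; nlinarith
  have hmod : q * i ≡ a + q * b [MOD (q ^ (m+1) - 1)] := by
    apply Nat.ModEq.symm
    have h1 : 0 < q ^ (m+1) := by positivity
    have h2 : q * i = a + q * b + (q ^ (m+1) - 1) * a := by
      rw [← e, Nat.sub_mul, one_mul]
      have : a ≤ q ^ (m+1) * a := Nat.le_mul_of_pos_left _ h1
      have h3 : q * (b + q ^ m * a) = q * b + q ^ (m+1) * a := by ring
      omega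
    rw [h2]
    simp [Nat.ModEq]
  refine ⟨a + q * b, ?_, by omega, by omega, ?_, hmod⟩
  · have : a + q * b ≠ q ^ (m+1) - 1 := by
      intro h
      rw [h, qwt_top hq] at hwj
      omega
    omega
  · have hrd : r ∣ q ^ (m+1) - 1 := by
      have := (Nat.modEq_iff_dvd' (Nat.one_le_pow _ _ (by omega))).1 (qpow_mod hq hrq (m+1)).symm
      exact this
    have h1 := hmod.of_dvd hrd
    have h2 : q * i ≡ 1 * i [MOD r] := by
      have := qpow_mod hq hrq 1
      rw [pow_one] at this
      exact this.mul_right i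
    have h3 := h1.symm.trans h2
    rw [one_mul] at h3
    rw [← hir]; exact h3
lemma sum_range_mul_aux (f : ℕ → ℕ) (a n : ℕ) :
    ∑ i ∈ Finset.range (a * n), f i = ∑ i ∈ Finset.range n, ∑ d ∈ Finset.range a, f (d + a * i) := by
  induction n with
  | zero => simp
  | succ n ih =>
    rw [mul_add, mul_one, Finset.sum_range_add, ih, Finset.sum_range_succ]
    congr 1
    exact Finset.sum_congr rfl fun d _ => by rw [add_comm]

lemma resid_one (r : ℕ) (hr : 1 < r) (x : ZMod r) :
    ∑ d ∈ Finset.range r, (if (d : ZMod r) = x then 1 else 0) = 1 := by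
  have : NeZero r := ⟨by omega⟩
  rw [Finset.sum_eq_single x.val]
  · simp
  · intro b hb hne
    rw [if_neg]
    intro h
    apply hne
    rw [← h, ZMod.val_natCast, Nat.mod_eq_of_lt (Finset.mem_range.1 hb)]
  · intro h
    exact absurd (Finset.mem_range.2 (ZMod.val_lt x)) h

lemma resid_count (r : ℕ) (hr : 1 < r) (k : ℕ) (x : ZMod r) :
    ∑ d ∈ Finset.range (r * k), (if (d : ZMod r) = x then 1 else 0) = k := by
  rw [sum_range_mul_aux (fun d => if (d : ZMod r) = x then 1 else 0)]
  simp only [Nat.cast_add, Nat.cast_mul, CharP.cast_eq_zero, zero_mul, add_zero]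
  rw [Finset.sum_congr rfl (fun _ _ => resid_one r hr x)]
  simp

lemma tot_count {q : ℕ} (hq : 1 < q) (m : ℕ) : ∀ w : ℕ,
    ∑ i ∈ Finset.range (q ^ m), (if qwt q i = w then 1 else 0) = m.choose w * (q - 1) ^ w := by
  induction m with
  | zero =>
    intro w
    cases w <;> simp [qwt_zero, -Finset.sum_boole]
  | succ m ih =>
    intro w
    obtain ⟨Q, rfl⟩ : ∃ Q, q = Q + 1 := ⟨q - 1, by omega⟩
    rw [pow_succ', sum_range_mul_aux (fun i => if qwt (Q+1) i = w then 1 else 0)]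
    have : ∀ i ∈ Finset.range ((Q+1) ^ m), ∑ d ∈ Finset.range (Q+1),
        (if qwt (Q+1) (d + (Q+1) * i) = w then 1 else 0)
        = Q * (if 1 + qwt (Q+1) i = w then 1 else 0) + (if qwt (Q+1) i = w then 1 else 0) := by
      intro i _
      rw [Finset.sum_range_succ']
      congr 1
      · rw [Finset.sum_congr rfl (g := fun _ => if 1 + qwt (Q+1) i = w then 1 else 0)]
        · rw [Finset.sum_const, Finset.card_range, smul_eq_mul]
        · intro d hd
          rw [qwt_add hq _ _ (by have := Finset.mem_range.1 hd; omega)]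
          simp
      · rw [qwt_add hq _ _ (by omega)]; simp
    rw [Finset.sum_congr rfl this, Finset.sum_add_distrib, ← Finset.mul_sum, ih]
    cases w with
    | zero => simp
    | succ w =>
      have : ∀ i, (1 + qwt (Q+1) i = w + 1) = (qwt (Q+1) i = w) := by
        intro i; simp; omega
      simp only [this, ih, Nat.choose_succ_succ, Nat.add_sub_cancel]
      ring

lemma res_count {q r : ℕ} (hq : 1 < q) (hr : 1 < r) (hrq : r ∣ q - 1) (m : ℕ) :
    ∀ (w : ℕ) (s : ZMod r),
    r * ∑ i ∈ Finset.range (q ^ m), (if qwt q i = w + 1 ∧ (i : ZMod r) = s then 1 else 0)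
      = m.choose (w + 1) * (q - 1) ^ (w + 1) := by
  induction m with
  | zero => intro w s; simp [qwt_zero]
  | succ m ih =>
    intro w s
    have hqr : ((q : ℕ) : ZMod r) = 1 := by
      have := (ZMod.natCast_eq_natCast_iff _ _ _).2 (qpow_mod hq hrq 1)
      simpa using this
    obtain ⟨Q, rfl⟩ : ∃ Q, q = Q + 1 := ⟨q - 1, by omega⟩
    obtain ⟨k, hk⟩ := hrq
    rw [Nat.add_sub_cancel] at hk
    rw [pow_succ', sum_range_mul_aux
      (fun i => if qwt (Q+1) i = w + 1 ∧ (i : ZMod r) = s then 1 else 0)]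
    have : ∀ i ∈ Finset.range ((Q+1) ^ m), ∑ d ∈ Finset.range (Q+1),
        (if qwt (Q+1) (d + (Q+1) * i) = w + 1 ∧ ((d + (Q+1) * i : ℕ) : ZMod r) = s then 1 else 0)
        = k * (if qwt (Q+1) i = w then 1 else 0) +
          (if qwt (Q+1) i = w + 1 ∧ (i : ZMod r) = s then 1 else 0) := by
      intro i _
      rw [Finset.sum_range_succ']
      congr 1
      · rw [Finset.sum_congr rfl (g := fun d : ℕ => (if qwt (Q+1) i = w then 1 else 0) *
          (if (d : ZMod r) = s - 1 - i then 1 else 0))]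
        · rw [← Finset.mul_sum, hk, resid_count r hr, mul_comm]
        · intro d hd
          rw [qwt_add hq _ _ (by have := Finset.mem_range.1 hd; omega)]
          rw [Nat.cast_add, Nat.cast_mul, hqr]
          have e1 : ((if d + 1 = 0 then 0 else 1) + qwt (Q+1) i = w + 1) = (qwt (Q+1) i = w) := by
            simp; omega
          have e2 : (((d + 1 : ℕ) : ZMod r) + 1 * i = s) = ((d : ZMod r) = s - 1 - i) := by
            apply propext
            push_cast
            constructor
            · intro h; rw [← h]; ring
            · intro h; rw [h]; ring
          simp only [e1, e2]
          by_cases h1 : qwt (Q+1) i = w <;> simp [h1]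
      · rw [qwt_add hq _ _ (by omega)]
        rw [Nat.cast_add, Nat.cast_mul, hqr]; simp
    rw [Finset.sum_congr rfl this, Finset.sum_add_distrib, ← Finset.mul_sum, tot_count hq,
      mul_add, ih]
    simp only [Nat.choose_succ_succ, Nat.add_sub_cancel]
    have hk2 : r * (k * (m.choose w * Q ^ w)) = Q * (m.choose w * Q ^ w) := by
      rw [← mul_assoc, ← hk]
    rw [hk2]
    ring

def DS (q m r l : ℕ) : Finset ℕ := (Finset.range (q ^ m - 1)).filter
          (fun i => 1 ≤ ((Nat.digits q i).filter (· ≠ 0)).length ∧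
            ((Nat.digits q i).filter (· ≠ 0)).length ≤ l ∧ i % r = 1)

lemma mem_DS {q m r l i : ℕ} : i ∈ DS q m r l ↔
    i < q ^ m - 1 ∧ 1 ≤ qwt q i ∧ qwt q i ≤ l ∧ i % r = 1 := by
  simp only [DS, Finset.mem_filter, Finset.mem_range, qwt]

lemma DS_card {q m r l : ℕ} (hq : 1 < q) (hr : 1 < r) (hrq : r ∣ q - 1) (hl : l < m) :
    (DS q m r l).card = (∑ i ∈ Finset.Icc 1 l, m.choose i * (q - 1) ^ i) / r := by
  symm
  apply Nat.div_eq_of_eq_mul_right (by omega)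
  rw [Finset.card_eq_sum_card_fiberwise (f := qwt q) (t := Finset.Icc 1 l), Finset.mul_sum]
  · apply Finset.sum_congr rfl
    intro w hw
    rw [Finset.mem_Icc] at hw
    obtain ⟨w, rfl⟩ : ∃ v, w = v + 1 := ⟨w - 1, by omega⟩
    rw [← res_count hq hr hrq m w 1, ← Finset.card_filter]
    congr 2
    ext i
    simp only [Finset.mem_filter, mem_DS, Finset.mem_range]
    have : ((i : ZMod r) = 1) ↔ i % r = 1 := by
      have := ZMod.natCast_eq_natCast_iff i 1 r
      rw [Nat.cast_one] at this
      rw [this, Nat.ModEq, Nat.mod_eq_of_lt hr]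
    rw [this]
    constructor
    · rintro ⟨h1, h2, h3⟩
      refine ⟨⟨?_, by omega, by omega, h3⟩, h2⟩
      rcases Nat.lt_or_ge i (q ^ m - 1) with h | h
      · exact h
      · have : i = q ^ m - 1 := by omega
        rw [this, qwt_top hq] at h2
        omega
    · rintro ⟨⟨h1, h2, h3, h4⟩, h5⟩
      exact ⟨by omega, h5, h4⟩
  · intro i hi
    have := mem_DS.1 hi
    simp; omega
open Polynomial in
lemma root_bound {E : Type*} [Field E] [DecidableEq E] {q m r l : ℕ} (hq : 1 < q) (hr : 1 < r)
    (hrq : r ∣ q - 1) (hl : l < m) (β : E) (hβ : orderOf β = q ^ m - 1)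
    (a : ℕ → E) (i0 : ℕ) (hi0 : i0 ∈ DS q m r l) (ha : a i0 ≠ 0) :
    ((Finset.univ : Finset (Fin ((q ^ m - 1) / r))).filter
      (fun t : Fin ((q ^ m - 1) / r) => ∑ i ∈ DS q m r l, a i * β ^ (i * (t : ℕ)) = 0)).card + q ^ (m - l)
        ≤ (q ^ m - 1) / r := by
  have hqm : 1 < q ^ m := Nat.one_lt_pow (by omega) hq
  have hrd : r ∣ q ^ m - 1 :=
    (Nat.modEq_iff_dvd' hqm.le).1 (qpow_mod hq hrq m).symm
  obtain ⟨n, hn⟩ := hrd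
  have hn' : (q ^ m - 1) / r = n := by rw [hn]; exact Nat.mul_div_cancel_left n (by omega)
  rw [hn']
  have hβ0 : β ≠ 0 := by
    rintro rfl
    rw [orderOf_zero] at hβ
    omega
  have hexp : ∀ i ∈ DS q m r l, i = 1 + r * ((i - 1) / r) ∧ (i - 1) / r + q ^ (m - l) ≤ n := by
    intro i hi
    obtain ⟨h1, h2, h3, h4⟩ := mem_DS.1 hi
    have e := Nat.mod_add_div i r
    have e2 : i - 1 = r * (i / r) := by omega
    have e3 : (i - 1) / r = i / r := by rw [e2]; exact Nat.mul_div_cancel_left _ (by omega)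
    refine ⟨by rw [e3]; omega, ?_⟩
    have hb := deg_bound hq hr hrq hl.le i (by omega) h3 h4
    rw [e3]
    have : r * (i / r + q ^ (m - l)) ≤ r * n := by rw [mul_add]; omega
    exact Nat.le_of_mul_le_mul_left this (by omega)
  set P : E[X] := ∑ i ∈ DS q m r l, C (a i) * X ^ ((i - 1) / r) with hP
  have hP0 : P ≠ 0 := by
    intro h
    have hc : P.coeff ((i0 - 1) / r) = a i0 := by
      rw [hP, finsetSum_coeff, Finset.sum_eq_single i0]
      · simp
      · intro b hb hne
        rw [coeff_C_mul_X_pow, if_neg]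
        intro h
        have h1 := (hexp b hb).1
        have h2 := (hexp i0 hi0).1
        rw [h] at h2
        omega
      · intro h; exact absurd hi0 h
    rw [h] at hc
    exact ha (by simpa using hc.symm)
  have hdeg : P.natDegree ≤ n - q ^ (m - l) := by
    apply natDegree_sum_le_of_forall_le
    intro i hi
    refine (natDegree_C_mul_X_pow_le _ _).trans ?_
    have := (hexp i hi).2
    omega
  have hle : q ^ (m - l) ≤ n := le_trans (Nat.le_add_left _ _) (hexp i0 hi0).2
  have hcard : ((Finset.univ : Finset (Fin n)).filter
      (fun t : Fin n => ∑ i ∈ DS q m r l, a i * β ^ (i * (t : ℕ)) = 0)).card ≤ P.roots.toFinset.card := by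
    apply Finset.card_le_card_of_injOn (fun t : Fin n => β ^ (r * (t : ℕ)))
    · intro t ht
      simp only [Finset.coe_filter, Finset.mem_univ, true_and, Set.mem_ofPred_eq] at ht
      simp only [Finset.mem_coe, Multiset.mem_toFinset]
      rw [mem_roots hP0, IsRoot.def, hP, eval_finsetSum]
      have : β ^ (t : ℕ) * ∑ i ∈ DS q m r l,
          eval (β ^ (r * (t : ℕ))) (C (a i) * X ^ ((i - 1) / r)) = 0 := by
        rw [← ht, Finset.mul_sum]
        apply Finset.sum_congr rfl
        intro i hi
        have hbe : β ^ (i * (t : ℕ)) = β ^ ((1 + r * ((i - 1) / r)) * (t : ℕ)) := by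
          rw [← (hexp i hi).1]
        rw [hbe]
        simp only [eval_mul, eval_C, eval_pow, eval_X]
        rw [← pow_mul, add_mul, one_mul, pow_add]
        rw [show r * (t : ℕ) * ((i - 1) / r) = r * ((i - 1) / r) * t by ring]
        ring
      exact (mul_eq_zero.1 this).resolve_left (pow_ne_zero _ hβ0)
    · intro s _ t _ h
      have hs := s.2
      have ht := t.2
      have := pow_injOn_Iio_orderOf (x := β) (x₁ := r * (s : ℕ)) (x₂ := r * (t : ℕ))
        (by rw [hβ, hn]; exact Nat.mul_lt_mul_of_pos_left hs (by omega))
        (by rw [hβ, hn]; exact Nat.mul_lt_mul_of_pos_left ht (by omega)) h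
      exact Fin.ext (Nat.eq_of_mul_eq_mul_left (by omega) this)
  have h2 := (Multiset.toFinset_card_le P.roots).trans (card_roots' P)
  omega

/-- vectors `h_i` -/
def hvec {E : Type*} [Field E] (β : E) (n : ℕ) (i : ℕ) : Fin n → E := fun t => β ^ (i * (t : ℕ))

lemma hvec_indep {E : Type*} [Field E] {q m r l : ℕ} (hq : 1 < q) (hr : 1 < r)
    (hrq : r ∣ q - 1) (hl : l < m) (β : E) (hβ : orderOf β = q ^ m - 1) :
    LinearIndependent E (fun i : DS q m r l => hvec β ((q ^ m - 1) / r) (i : ℕ)) := by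
  classical
  rw [Fintype.linearIndependent_iff]
  intro g hg i0
  by_contra hne
  have := root_bound hq hr hrq hl β hβ (fun i => if h : i ∈ DS q m r l then g ⟨i, h⟩ else 0) i0 i0.2
    (by simpa using hne)
  rw [Finset.filter_true_of_mem] at this
  · simp at this
    omega
  · intro t _
    have h := congrFun hg t
    simp only [Finset.sum_apply, Pi.smul_apply, smul_eq_mul, Pi.zero_apply, hvec] at h
    rw [← h, ← Finset.sum_coe_sort]
    apply Finset.sum_congr rfl
    intro i _
    simp

noncomputable abbrev dotB (K : Type*) [Field K] (n : ℕ) : LinearMap.BilinForm K (Fin n → K) :=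
  dotProductBilin K K

lemma dotB_symm (K : Type*) [Field K] (n : ℕ) : (dotB K n).IsRefl := by
  intro x y h
  simp only [dotProductBilin_apply_apply] at h ⊢
  rw [dotProduct_comm]; exact h

lemma dotB_nondeg (K : Type*) [Field K] (n : ℕ) : (dotB K n).Nondegenerate := by
  constructor
  · intro x h
    exact dotProduct_eq_zero x h
  · intro x h
    apply dotProduct_eq_zero x
    intro y; rw [dotProduct_comm]; exact h y

lemma dualCode_eq {F : Type*} [Field F] {n : ℕ} (C : Submodule F (Fin n → F)) :
    dualCode C = (dotB F n).orthogonal C := by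
  ext b
  simp [dualCode, LinearMap.BilinForm.mem_orthogonal_iff, dotProduct]

lemma mem_consta {F E : Type*} [Field F] [Field E] [Algebra F E]
    (β : E) (D : Finset ℕ) (n : ℕ) (c : Fin n → F) :
    c ∈ constaCode β D n ↔ ∀ i ∈ D, ∑ t : Fin n, β ^ (i * (t : ℕ)) * algebraMap F E (c t) = 0 := by
  simp [constaCode]

lemma finrank_le_of_map {F E : Type*} [Field F] [Field E] [Algebra F E] {n : ℕ}
    (U : Submodule F (Fin n → F)) (W : Submodule E (Fin n → E))
    (h : ∀ u ∈ U, (algebraMap F E ∘ u) ∈ W) : Module.finrank F U ≤ Module.finrank E W := by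
  let b := Module.finBasis F U
  have h1 : LinearIndependent F (fun i => (b i : Fin n → F)) :=
    b.linearIndependent.map' U.subtype (by simp)
  have h2 : LinearIndependent E (fun i => algebraMap F E ∘ (b i : Fin n → F)) :=
    (linearIndependent_algebraMap_comp_iff (S := E)).2 h1
  have h3 : LinearIndependent E (fun i => (⟨algebraMap F E ∘ (b i : Fin n → F),
      h _ (b i).2⟩ : W)) := by
    apply LinearIndependent.of_comp W.subtype
    exact h2
  have := h3.fintype_card_le_finrank
  simpa using this

lemma rot_iter {E : Type*} [Field E] {q m r l : ℕ} (hq : 1 < q) (hr : 1 < r)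
    (hrq : r ∣ q - 1) (hl : l < m) (β : E) (hβ : orderOf β = q ^ m - 1) (k : ℕ) :
    ∀ i ∈ DS q m r l, ∃ j ∈ DS q m r l, β ^ (i * q ^ k) = β ^ j := by
  induction k with
  | zero => intro i hi; exact ⟨i, hi, by simp⟩
  | succ k ih =>
    intro i hi
    obtain ⟨j, hj, e⟩ := ih i hi
    obtain ⟨h1, h2, h3, h4⟩ := mem_DS.1 hj
    obtain ⟨j', a1, a2, a3, a4, a5⟩ := rot hq hr hrq hl j h1 h2 h3 h4
    refine ⟨j', mem_DS.2 ⟨a1, a2, a3, a4⟩, ?_⟩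
    rw [pow_succ, ← mul_assoc, pow_mul, e, ← pow_mul, mul_comm]
    rw [← hβ] at a5
    rw [← pow_mod_orderOf, a5, pow_mod_orderOf]

lemma dual_mem {F E : Type*} [Field F] [Fintype F] [Field E] [Fintype E]
    [Algebra F E] {q m r l : ℕ} (hqF : q = Fintype.card F) (hq : 1 < q) (hr : 1 < r)
    (hrq : r ∣ q - 1) (hl : l < m) (β : E) (hβ : orderOf β = q ^ m - 1) (n : ℕ)
    (b : Fin n → F) (hb : b ∈ dualCode (constaCode (F := F) β (DS q m r l) n)) :
    (algebraMap F E ∘ b) ∈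
      Submodule.span E (Set.range (fun i : DS q m r l => hvec β n (i : ℕ))) := by
  let T : Submodule F (Fin n → F) := Submodule.span F
    {v | ∃ (a : E), ∃ i ∈ DS q m r l, v = fun t : Fin n => Algebra.trace F E (a * β ^ (i * (t : ℕ)))}
  have hT : (dotB F n).orthogonal T ≤ constaCode β (DS q m r l) n := by
    intro c hc
    rw [mem_consta]
    intro i hi
    apply (traceForm_nondegenerate F E).1
    intro a
    have := (LinearMap.BilinForm.mem_orthogonal_iff.1 hc) _
      (Submodule.subset_span ⟨a, i, hi, rfl⟩)
    simp only [dotProductBilin_apply_apply, dotProduct] at this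
    rw [Algebra.traceForm_apply, Finset.sum_mul, map_sum, ← this]
    apply Finset.sum_congr rfl
    intro t _
    rw [mul_comm (β ^ _), mul_assoc, ← Algebra.smul_def, map_smul, smul_eq_mul, mul_comm,
      mul_comm a]
  have hbT : b ∈ T := by
    rw [dualCode_eq] at hb
    have := LinearMap.BilinForm.orthogonal_le hT hb
    rwa [LinearMap.BilinForm.orthogonal_orthogonal (dotB_nondeg F n) (dotB_symm F n)] at this
  clear hb hT
  induction hbT using Submodule.span_induction with
  | mem x hx =>
    obtain ⟨a, i, hi, rfl⟩ := hx
    have : (algebraMap F E ∘ fun t : Fin n => Algebra.trace F E (a * β ^ (i * (t : ℕ))))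
        = ∑ k ∈ Finset.range (Module.finrank F E), a ^ (q ^ k) • hvec β n (i * q ^ k) := by
      funext t
      simp only [Function.comp, Finset.sum_apply, Pi.smul_apply, smul_eq_mul, hvec]
      rw [FiniteField.algebraMap_trace_eq_sum_pow, Nat.card_eq_fintype_card, ← hqF]
      apply Finset.sum_congr rfl
      intro k _
      rw [mul_pow, ← pow_mul]
      congr 2; ring
    rw [this]
    apply Submodule.sum_mem
    intro k _
    apply Submodule.smul_mem
    obtain ⟨j, hj, e⟩ := rot_iter hq hr hrq hl β hβ k i hi
    apply Submodule.subset_span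
    refine ⟨⟨j, hj⟩, ?_⟩
    funext t
    simp only [hvec]
    rw [pow_mul, pow_mul β (i * q ^ k), e]
  | zero =>
    convert Submodule.zero_mem _
    funext t; simp
  | add x y _ _ hx hy =>
    convert Submodule.add_mem _ hx hy
    funext t; simp
  | smul a x _ hx =>
    convert Submodule.smul_mem _ (algebraMap F E a) hx
    funext t; simp

theorem stmt_12 {F E : Type*} [Field F] [Fintype F] [DecidableEq F] [Field E] [Fintype E]
    [Algebra F E]
    (q m r ℓ : ℕ) (hq : q = Fintype.card F) (hE : Fintype.card E = q ^ m)
    (hm : 2 ≤ m) (hr : 1 < r) (hrq : r ∣ q - 1) (hℓ1 : 1 ≤ ℓ) (hℓ2 : ℓ ≤ m - 1)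
    (β : E) (hβ : orderOf β = q ^ m - 1) :
    Module.finrank F ↥(dualCode (constaCode (F := F) β
        ((Finset.range (q ^ m - 1)).filter
          (fun i => 1 ≤ ((Nat.digits q i).filter (· ≠ 0)).length ∧
            ((Nat.digits q i).filter (· ≠ 0)).length ≤ ℓ ∧ i % r = 1))
        ((q ^ m - 1) / r)))
      = (∑ i ∈ Finset.Icc 1 ℓ, m.choose i * (q - 1) ^ i) / r ∧
    ∀ b ∈ dualCode (constaCode (F := F) β
        ((Finset.range (q ^ m - 1)).filter
          (fun i => 1 ≤ ((Nat.digits q i).filter (· ≠ 0)).length ∧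
            ((Nat.digits q i).filter (· ≠ 0)).length ≤ ℓ ∧ i % r = 1))
        ((q ^ m - 1) / r)),
      b ≠ 0 → q ^ (m - ℓ) ≤ (Finset.univ.filter (fun t => b t ≠ 0)).card := by
  classical
  have hq1 : 1 < q := hq ▸ Fintype.one_lt_card
  have hl : ℓ < m := by omega
  change Module.finrank F ↥(dualCode (constaCode (F := F) β (DS q m r ℓ) ((q ^ m - 1) / r)))
      = _ ∧ ∀ b ∈ dualCode (constaCode (F := F) β (DS q m r ℓ) ((q ^ m - 1) / r)), _
  have hind := hvec_indep hq1 hr hrq hl β hβ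
  have hmem := dual_mem (F := F) hq hq1 hr hrq hl β hβ ((q ^ m - 1) / r)
  have hrb := root_bound hq1 hr hrq hl β hβ
  generalize (q ^ m - 1) / r = n at *
  set C := constaCode (F := F) β (DS q m r ℓ) n with hC
  set W := Submodule.span E (Set.range (fun i : DS q m r ℓ => hvec β n (i : ℕ))) with hW
  have hWr : Module.finrank E W = (DS q m r ℓ).card := by
    rw [hW, finrank_span_eq_card hind, Fintype.card_coe]
  constructor
  · rw [← DS_card hq1 hr hrq hl]
    apply le_antisymm
    · rw [← hWr]
      exact finrank_le_of_map _ _ hmem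
    · have h1 : Module.finrank F C ≤ Module.finrank E ((dotB E n).orthogonal W) := by
        apply finrank_le_of_map
        intro c hc
        rw [hC, mem_consta] at hc
        rw [LinearMap.BilinForm.mem_orthogonal_iff]
        intro w hw
        induction hw using Submodule.span_induction with
        | mem x hx =>
          obtain ⟨i, rfl⟩ := hx
          exact hc i i.2
        | zero => simp
        | add x y _ _ hx hy => rw [map_add, LinearMap.add_apply, hx, hy, add_zero]
        | smul a x _ hx => rw [map_smul, LinearMap.smul_apply, hx, smul_zero]
      have h2 := LinearMap.BilinForm.finrank_orthogonal (dotB_nondeg E n) W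
      have h3 := LinearMap.BilinForm.finrank_orthogonal (dotB_nondeg F n) C
      have h4 := Submodule.finrank_le W
      rw [dualCode_eq, h3]
      rw [Module.finrank_fin_fun] at *
      omega
  · intro b hb hb0
    have hbW := hmem b hb
    rw [hW, Submodule.mem_span_range_iff_exists_fun] at hbW
    obtain ⟨g, hg⟩ := hbW
    have hgne : ∃ i, g i ≠ 0 := by
      by_contra! h
      apply hb0
      funext t
      have := congrFun hg t
      simp [h] at this
      simpa using this.symm
    obtain ⟨i0, hi0⟩ := hgne
    have hkey := hrb (fun i => if h : i ∈ DS q m r ℓ then g ⟨i, h⟩ else 0) i0 i0.2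
      (by simpa using hi0)
    have hfil : (Finset.univ.filter (fun t : Fin n => ∑ i ∈ DS q m r ℓ,
        (if h : i ∈ DS q m r ℓ then g ⟨i, h⟩ else 0) * β ^ (i * (t : ℕ)) = 0))
        = Finset.univ.filter (fun t : Fin n => b t = 0) := by
      ext t
      simp only [Finset.mem_filter, Finset.mem_univ, true_and]
      have h := congrFun hg t
      simp only [Finset.sum_apply, Pi.smul_apply, smul_eq_mul, hvec, Function.comp] at h
      rw [← map_eq_zero (algebraMap F E), ← h, ← Finset.sum_coe_sort]
      simp
    rw [hfil] at hkey
    have hs := Finset.card_filter_add_card_filter_not (s := (Finset.univ : Finset (Fin n)))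
      (fun t => b t = 0)
    rw [Finset.card_univ, Fintype.card_fin] at hs
    simp only [ne_eq]
    omega
end

section
/- Let q be an odd prime power, m ≥ 2, and r = (q-1)/2 > 1. Then the λ-constacyclic code C'(q,m,r,1) of length n = 2(q^m-1)/(q-1) over GF(q) has dimension n - 2m and minimum distance exactly 4; in particular it meets the sphere-packing bound constraint that forces d ≤ 4 and the BCH bound that forces d ≥ 4. -/
open Polynomial IntermediateField in
lemma h_adj {F E : Type*} [Field F] [Fintype F] [Field E] [Fintype E] [Algebra F E]
    (q m s : ℕ) (hq : q = Fintype.card F) (hq2 : 2 ≤ q) (hE : Fintype.card E = q ^ m)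
    (β : E) (hβ : orderOf β = q ^ m - 1) (hb0 : β ≠ 0) (hs : 1 ≤ s) (hsq : s < q) (u : E) :
    ∃ p : F[X], aeval (β ^ s) p = u := by
  have hm' : Module.finrank F E = m := by
    have h := Module.card_eq_pow_finrank (K := F) (V := E)
    rw [hE, ← hq] at h
    exact (Nat.pow_right_injective hq2 h).symm
  have htop : F⟮β ^ s⟯ = ⊤ := by
    apply IntermediateField.eq_of_le_of_finrank_eq le_top
    rw [IntermediateField.finrank_top', hm']
    have hle : Module.finrank F F⟮β ^ s⟯ ≤ m := by
      rw [← hm']; exact Submodule.finrank_le F⟮β ^ s⟯.toSubalgebra.toSubmodule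
    by_contra hne
    have hlt : Module.finrank F F⟮β ^ s⟯ < m := lt_of_le_of_ne hle hne
    have : Fintype F⟮β ^ s⟯ := Fintype.ofFinite _
    have hc := Module.card_eq_pow_finrank (K := F) (V := F⟮β ^ s⟯)
    set d := Module.finrank F F⟮β ^ s⟯ with hd
    have h1 := FiniteField.pow_card_sub_one_eq_one (AdjoinSimple.gen F (β ^ s))
      (by
        intro h
        have := congrArg (algebraMap F⟮β ^ s⟯ E) h
        rw [AdjoinSimple.algebraMap_gen, map_zero] at this
        exact pow_ne_zero _ hb0 this)
    have h2 := congrArg (algebraMap F⟮β ^ s⟯ E) h1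
    rw [map_pow, AdjoinSimple.algebraMap_gen, map_one, ← pow_mul, hc, ← hq] at h2
    have h3 := orderOf_dvd_of_pow_eq_one h2
    rw [hβ] at h3
    have hdpos : 0 < d := Module.finrank_pos
    have hqd : q ≤ q ^ d := Nat.le_self_pow hdpos.ne' q
    have hqm : q ^ (d + 1) ≤ q ^ m := Nat.pow_le_pow_right (by omega) hlt
    have h4 := Nat.le_of_dvd (Nat.mul_pos hs (by omega)) h3
    obtain ⟨e, he⟩ : ∃ e, q ^ d = e + 1 := ⟨q ^ d - 1, by omega⟩
    rw [pow_succ] at hqm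
    rw [he] at hqm h4
    have h5 : s * e ≤ q * e := Nat.mul_le_mul_right _ hsq.le
    simp only [Nat.add_sub_cancel] at h4
    have : (e + 1) * q = q * e + q := by ring
    omega
  have : u ∈ F⟮β ^ s⟯.toSubalgebra := by
    rw [htop]; trivial
  rw [IntermediateField.adjoin_simple_toSubalgebra_of_isAlgebraic
    (Algebra.IsAlgebraic.isAlgebraic _), Algebra.adjoin_singleton_eq_range_aeval] at this
  exact this

lemma h_aut {F E : Type*} [Field F] [Fintype F] [Field E] [Fintype E] [Algebra F E]
    (σ : E ≃ₐ[F] E) : ∃ k < Module.finrank F E, ∀ x, σ x = x ^ Fintype.card F ^ k := by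
  obtain ⟨k, hk⟩ := (FiniteField.bijective_frobeniusAlgEquivOfAlgebraic_pow F E).2 σ
  refine ⟨k, k.2, fun x => ?_⟩
  rw [← hk]
  have := congrFun (FiniteField.coe_frobeniusAlgEquivOfAlgebraic_iterate F E k) x
  rw [← this]
  simp only [AlgEquiv.coe_pow]

lemma h_mem {F E : Type*} [Field F] [Fintype F] [Field E] [Fintype E] [Algebra F E]
    (x : E) (hx : x ^ Fintype.card F = x) : ∃ l : F, algebraMap F E l = x := by
  have : x ∈ (⊥ : IntermediateField F E) := by
    rw [IsGalois.mem_bot_iff_fixed]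
    intro σ
    obtain ⟨k, -, hk⟩ := h_aut σ
    rw [hk]
    clear hk
    induction k with
    | zero => simp
    | succ k ih => rw [pow_succ, pow_mul, ih, hx]
  exact IntermediateField.mem_bot.1 this

open Polynomial in
lemma h_cop {F E : Type*} [Field F] [Fintype F] [Field E] [Fintype E] [Algebra F E]
    (q m s : ℕ) (hq : q = Fintype.card F) (hq2 : 3 ≤ q) (hE : Fintype.card E = q ^ m)
    (hm : 2 ≤ m)
    (β : E) (hβ : orderOf β = q ^ m - 1) (hs : 1 < s) (hsq : s < q) :
    IsCoprime (minpoly F β) (minpoly F (β ^ s)) := by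
  have hm' : Module.finrank F E = m := by
    have h := Module.card_eq_pow_finrank (K := F) (V := E)
    rw [hE, ← hq] at h
    exact (Nat.pow_right_injective (by omega) h).symm
  have hi : IsIntegral F β := Algebra.IsIntegral.isIntegral _
  have hi' : IsIntegral F (β ^ s) := Algebra.IsIntegral.isIntegral _
  rcases (minpoly.irreducible hi).isCoprime_or_dvd (minpoly F (β ^ s)) with h | h
  · exact h
  exfalso
  have heq : minpoly F (β ^ s) = minpoly F β :=
    (Polynomial.eq_of_monic_of_associated (minpoly.monic hi) (minpoly.monic hi')
      ((minpoly.irreducible hi).associated_of_dvd (minpoly.irreducible hi') h)).symm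
  obtain ⟨σ, hσ⟩ := isConjRoot_iff_exists_algEquiv.1 (show IsConjRoot F (β ^ s) β from heq)
  obtain ⟨k, hk, hk'⟩ := h_aut σ
  rw [hk', ← hq] at hσ
  rw [hm'] at hk
  have hqk : q ^ (k + 1) ≤ q ^ m := Nat.pow_le_pow_right (by omega) hk
  have hqm : q ^ 2 ≤ q ^ m := Nat.pow_le_pow_right (by omega) hm
  have hqk0 : 1 ≤ q ^ k := Nat.one_le_pow _ _ (by omega)
  have := pow_injOn_Iio_orderOf (x := β) (x₁ := q ^ k) (x₂ := s)
    (by rw [hβ, Set.mem_Iio]; rw [pow_succ] at hqk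
        have : q ^ k * 3 ≤ q ^ k * q := Nat.mul_le_mul_left _ hq2
        omega)
    (by rw [hβ, Set.mem_Iio]; have : 3 * q ≤ q ^ 2 := by nlinarith
        omega) hσ
  rcases Nat.eq_zero_or_pos k with h0 | h0
  · subst h0; simp at this; omega
  · have : q ≤ q ^ k := Nat.le_self_pow h0.ne' q
    omega

lemma h_dig (q : ℕ) (hq : 2 ≤ q) : ∀ i, ((Nat.digits q i).filter (· ≠ 0)).length = 1 →
    ∃ a j, 0 < a ∧ a < q ∧ i = a * q ^ j := by
  intro i
  induction i using Nat.strong_induction_on with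
  | _ i ih =>
    intro h
    rcases Nat.eq_zero_or_pos i with h0 | h0
    · subst h0; simp at h
    rw [Nat.digits_def' (by omega) h0] at h
    by_cases hz : i % q = 0
    · rw [List.filter_cons_of_neg (by simpa using hz)] at h
      obtain ⟨a, j, h1, h2, h3⟩ := ih (i / q) (Nat.div_lt_self h0 hq) h
      refine ⟨a, j + 1, h1, h2, ?_⟩
      have := Nat.div_add_mod i q
      rw [hz, h3] at this
      rw [← this]; ring
    · rw [List.filter_cons_of_pos (by simpa using hz)] at h
      refine ⟨i % q, 0, by omega, Nat.mod_lt _ (by omega), ?_⟩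
      have h' : (Nat.digits q (i / q)).filter (· ≠ 0) = [] := by
        apply List.eq_nil_of_length_eq_zero
        simpa using h
      have : i / q = 0 := by
        by_contra hne
        have hne' := (Nat.digits_ne_nil_iff_ne_zero (b := q)).2 hne
        have hl := Nat.getLast_digit_ne_zero q hne
        have := List.filter_eq_nil_iff.1 h' _ (List.getLast_mem hne')
        simp at this
        exact hl this
      have h2 := Nat.div_add_mod i q
      rw [this] at h2
      simp at h2 ⊢
      exact h2.symm

/-- evaluation -/
noncomputable def evl (F : Type*) {E : Type*} [Field F] [Field E] [Algebra F E] (n : ℕ) (x : E) :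
    (Fin n → F) →ₗ[F] E :=
  ∑ t : Fin n, (x ^ (t : ℕ)) •
      ((Algebra.linearMap F E).comp (LinearMap.proj t : (Fin n → F) →ₗ[F] F))

lemma evl_apply {F E : Type*} [Field F] [Field E] [Algebra F E] (n : ℕ) (x : E) (c : Fin n → F) :
    evl F n x c = ∑ t : Fin n, x ^ (t : ℕ) * algebraMap F E (c t) := by
  simp [evl]

lemma evl_frob {F E : Type*} [Field F] [Fintype F] [Field E] [Algebra F E] (n : ℕ) (x : E)
    (c : Fin n → F) (h : evl F n x c = 0) : evl F n (x ^ Fintype.card F) c = 0 := by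
  have := congrArg (FiniteField.frobeniusAlgHom F E) h
  rw [evl_apply, map_sum, map_zero] at this
  rw [evl_apply, ← this]
  refine Finset.sum_congr rfl fun t _ => ?_
  rw [map_mul, map_pow, AlgHom.commutes]
  simp [FiniteField.coe_frobeniusAlgHom]

lemma code_mem {F E : Type*} [Field F] [Fintype F] [Field E] [Algebra F E]
    (q m r n : ℕ) (hq : q = Fintype.card F) (hqr : q = 2 * r + 1) (hm : 2 ≤ m) (hr : 1 < r)
    (β : E) (c : Fin n → F) :
    c ∈ constaCode (F := F) β
        ((Finset.range (q ^ m - 1)).filter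
          (fun i => ((Nat.digits q i).filter (· ≠ 0)).length = 1 ∧ i % r = 1)) n ↔
      evl F n β c = 0 ∧ evl F n (β ^ (r + 1)) c = 0 := by
  have key : c ∈ constaCode (F := F) β
        ((Finset.range (q ^ m - 1)).filter
          (fun i => ((Nat.digits q i).filter (· ≠ 0)).length = 1 ∧ i % r = 1)) n ↔
      ∀ i, i < q ^ m - 1 → ((Nat.digits q i).filter (· ≠ 0)).length = 1 → i % r = 1 →
        evl F n (β ^ i) c = 0 := by
    simp only [constaCode, Submodule.mem_iInf, Finset.mem_filter, Finset.mem_range, and_imp,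
      LinearMap.mem_ker, evl, pow_mul]
  have hqm : q ^ 2 ≤ q ^ m := Nat.pow_le_pow_right (by omega) hm
  have hq3 : 3 * q ≤ q ^ 2 := by nlinarith
  rw [key]
  constructor
  · intro h
    refine ⟨?_, ?_⟩
    · have := h 1 (by omega) (by rw [Nat.digits_of_lt q 1 (by omega) (by omega)]; simp)
        (Nat.mod_eq_of_lt hr)
      simpa using this
    · refine h (r + 1) (by omega) ?_ ?_
      · rw [Nat.digits_of_lt q (r + 1) (by omega) (by omega)]; simp
      · rw [Nat.add_mod_left]; exact Nat.mod_eq_of_lt hr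
  · rintro ⟨h1, h2⟩ i - hd hir
    obtain ⟨a, j, ha, haq, rfl⟩ := h_dig q (by omega) i hd
    have hqj : q ^ j ≡ 1 [MOD r] := by
      have : q ≡ 1 [MOD r] := by
        rw [hqr]; simp [Nat.ModEq, Nat.add_mod]
      simpa using this.pow j
    have har : a % r = 1 := by
      have := hqj.mul_left a
      rw [mul_one] at this
      rw [← hir]; exact this.symm
    have ha' : a = 1 ∨ a = r + 1 := by
      have h3 := Nat.div_add_mod a r
      rw [har] at h3
      have h4 : a / r < 2 := by
        by_contra hcon
        have : r * 2 ≤ r * (a / r) := Nat.mul_le_mul_left _ (by omega)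
        omega
      interval_cases hh : a / r <;> omega
    have hb : evl F n (β ^ a) c = 0 := by
      rcases ha' with rfl | rfl
      · simpa using h1
      · exact h2
    clear hd hir hqj
    induction j with
    | zero => simpa using hb
    | succ j ih =>
      have := evl_frob n _ c ih
      rw [← hq, ← pow_mul] at this
      rw [pow_succ, ← mul_assoc]; exact this

open Polynomial in
lemma h_surj {F E : Type*} [Field F] [Fintype F] [Field E] [Fintype E] [Algebra F E]
    (q m r n : ℕ) (hq : q = Fintype.card F) (hqr : q = 2 * r + 1) (hm : 2 ≤ m) (hr : 1 < r)
    (hE : Fintype.card E = q ^ m) (hn : n * r = q ^ m - 1)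
    (β : E) (hβ : orderOf β = q ^ m - 1) (hb0 : β ≠ 0) :
    Function.Surjective ((evl F n β).prod (evl F n (β ^ (r + 1)))) := by
  rintro ⟨u, v⟩
  obtain ⟨p1, hp1⟩ := h_adj (F := F) q m 1 hq (by omega) hE β hβ hb0 le_rfl (by omega) u
  obtain ⟨p2, hp2⟩ := h_adj (F := F) q m (r + 1) hq (by omega) hE β hβ hb0 (by omega) (by omega) v
  obtain ⟨a, b, hab⟩ := h_cop (F := F) q m (r + 1) hq (by omega) hE hm β hβ (by omega) (by omega)
  rw [pow_one] at hp1
  have hnr : (β ^ n) ^ r = 1 := by rw [← pow_mul, hn, ← hβ, pow_orderOf_eq_one]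
  obtain ⟨l, hl⟩ := h_mem (F := F) (β ^ n) (by
    rw [← hq, hqr, pow_succ, mul_comm 2 r, pow_mul, hnr, one_pow, one_mul])
  have hn0 : n ≠ 0 := by
    rintro rfl
    have hqm : q ^ 2 ≤ q ^ m := Nat.pow_le_pow_right (by omega) hm
    have hq3 : 3 * q ≤ q ^ 2 := by nlinarith
    omega
  set P := p1 * (b * minpoly F (β ^ (r + 1))) + p2 * (a * minpoly F β) with hP
  have hab1 := congrArg (aeval β) hab
  have hab2 := congrArg (aeval (β ^ (r + 1))) hab
  simp only [map_add, map_mul, minpoly.aeval, mul_zero, zero_add, add_zero, map_one] at hab1 hab2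
  have hPu : aeval β P = u := by
    simp only [hP, map_add, map_mul, minpoly.aeval, mul_zero, add_zero, hp1, hab1, mul_one]
  have hPv : aeval (β ^ (r + 1)) P = v := by
    simp only [hP, map_add, map_mul, minpoly.aeval, mul_zero, zero_add, hp2, hab2, mul_one]
  have hmon : (X ^ n - C l : F[X]).Monic := monic_X_pow_sub_C l hn0
  have hdeg : (P %ₘ (X ^ n - C l)).natDegree < n := by
    have := natDegree_modByMonic_lt P hmon (by
      intro h
      have := congrArg natDegree h
      rw [natDegree_X_pow_sub_C, natDegree_one] at this
      exact hn0 this)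
    rwa [natDegree_X_pow_sub_C] at this
  have hev : ∀ x : E, x ^ n = algebraMap F E l →
      evl F n x (fun t => (P %ₘ (X ^ n - C l)).coeff t) = aeval x P := by
    intro x hx
    have h1 : aeval x (P %ₘ (X ^ n - C l)) = aeval x P := by
      conv_rhs => rw [← modByMonic_add_div P (X ^ n - C l)]
      simp [hx]
    rw [← h1, aeval_eq_sum_range' hdeg, evl_apply, Finset.sum_range]
    refine Finset.sum_congr rfl fun t _ => ?_
    rw [Algebra.smul_def, mul_comm]
  refine ⟨fun t => (P %ₘ (X ^ n - C l)).coeff t, ?_⟩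
  rw [LinearMap.prod_apply]
  refine Prod.ext ?_ ?_
  · change evl F n β _ = u
    rw [hev β hl.symm, hPu]
  · change evl F n (β ^ (r + 1)) _ = v
    rw [hev _ ?_, hPv]
    rw [← pow_mul, mul_comm, pow_mul, pow_succ, hnr, one_mul, hl]

open Polynomial in
lemma h_low {F E : Type*} [Field F] [Fintype F] [DecidableEq F] [Field E] [Algebra F E]
    (q r n : ℕ) (hq : q = Fintype.card F) (hqr : q = 2 * r + 1)
    (β : E) (hβ : orderOf β = n * r) (hr : 1 < r) (hb0 : β ≠ 0) (c : Fin n → F) (hc : c ≠ 0)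
    (h1 : evl F n β c = 0) (h2 : evl F n (β ^ (r + 1)) c = 0) :
    4 ≤ (Finset.univ.filter (fun t => c t ≠ 0)).card := by
  by_contra hlt
  obtain ⟨t0, ht0⟩ := Function.ne_iff.1 hc
  have ht0' : c t0 ≠ 0 := ht0
  have h3 := evl_frob n β c h1
  rw [← hq] at h3
  set T := (Finset.univ.filter (fun t => c t ≠ 0)).erase t0 with hT
  have hTc : T.card < 3 := by
    rw [hT, Finset.card_erase_of_mem (by simpa using ht0')]
    omega
  set P : E[X] := ∏ t ∈ T, (X - C (β ^ (r * (t : ℕ)))) with hP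
  have hdeg : P.natDegree < 3 := by
    rw [hP, natDegree_finsetProd_X_sub_C_eq_card]; exact hTc
  have hk : ∀ k < 3, ∑ t : Fin n, algebraMap F E (c t) * β ^ (t : ℕ) * (β ^ (r * (t : ℕ))) ^ k = 0 := by
    intro k hk
    have : evl F n (β ^ (1 + r * k)) c = 0 := by
      interval_cases k
      · simpa using h1
      · rwa [mul_one, add_comm]
      · rwa [mul_comm r 2, add_comm, ← hqr]
    rw [← this, evl_apply]
    refine Finset.sum_congr rfl fun t _ => ?_
    rw [← pow_mul, ← pow_mul, mul_assoc, ← pow_add, mul_comm]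
    congr 2; ring
  have hsum : ∑ t : Fin n, algebraMap F E (c t) * β ^ (t : ℕ) * P.eval (β ^ (r * (t : ℕ))) = 0 := by
    simp only [eval_eq_sum_range' hdeg, Finset.mul_sum]
    rw [Finset.sum_comm]
    refine Finset.sum_eq_zero fun k hk' => ?_
    have := hk k (Finset.mem_range.1 hk')
    rw [← mul_zero (P.coeff k), ← this, Finset.mul_sum]
    refine Finset.sum_congr rfl fun t _ => ?_
    ring
  rw [Finset.sum_eq_single t0] at hsum
  · have hne : P.eval (β ^ (r * (t0 : ℕ))) ≠ 0 := by
      rw [hP, eval_prod, Finset.prod_ne_zero_iff]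
      intro t ht
      rw [eval_sub, eval_X, eval_C, sub_ne_zero]
      intro heq
      have hr0 : ∀ t : Fin n, r * (t : ℕ) < orderOf β := by
        intro t
        rw [hβ, mul_comm]
        exact Nat.mul_lt_mul_of_pos_right t.2 (by omega)
      have := pow_injOn_Iio_orderOf (hr0 t0) (hr0 t) heq
      have := Nat.eq_of_mul_eq_mul_left (by omega) this
      rw [hT, Finset.mem_erase] at ht
      exact ht.1 (Fin.ext this.symm)
    have hca : algebraMap F E (c t0) ≠ 0 := by
      simpa using ht0'
    exact mul_ne_zero (mul_ne_zero hca (pow_ne_zero _ hb0)) hne hsum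
  · intro t _ htt
    by_cases hct : c t = 0
    · simp [hct]
    · have : t ∈ T := by simp [hT, htt, hct]
      rw [hP, eval_prod, Finset.prod_eq_zero this (by simp), mul_zero]
  · simp

/-- weight two vectors -/
def wtwo {F : Type*} [Field F] (n : ℕ) (x : (Σ t : Fin n, Fin t) × Fˣ × Fˣ) : Fin n → F :=
  fun i => if i = x.1.1 then (x.2.1 : F) else if (i : ℕ) = x.1.2 then (x.2.2 : F) else 0

lemma wtwo_inj {F : Type*} [Field F] (n : ℕ) : Function.Injective (wtwo (F := F) n) := by
  rintro ⟨⟨t, s⟩, a, b⟩ ⟨⟨t', s'⟩, a', b'⟩ h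
  have hs := s.2
  have hs' := s'.2
  have ha := a.ne_zero
  have hb := b.ne_zero
  have ha' := a'.ne_zero
  have hb' := b'.ne_zero
  have e1 := congrFun h t
  have e2 := congrFun h t'
  have e3 := congrFun h ⟨s, by omega⟩
  have e4 := congrFun h ⟨s', by omega⟩
  simp only [wtwo, Fin.ext_iff] at e1 e2 e3 e4
  have htt : t = t' := by
    ext; grind
  subst htt
  have hss : s = s' := by
    ext; grind
  subst hss
  have : a = a' := by ext; grind
  have : b = b' := by ext; grind
  simp_all

lemma h_ex {F E : Type*} [Field F] [Fintype F] [DecidableEq F] [Field E] [Fintype E] [Algebra F E]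
    (q m r n : ℕ) (hq : q = Fintype.card F) (hqr : q = 2 * r + 1) (hm : 2 ≤ m) (hr : 1 < r)
    (hE : Fintype.card E = q ^ m) (hn : n * r = q ^ m - 1) (f : (Fin n → F) →ₗ[F] E × E) :
    ∃ c, f c = 0 ∧ c ≠ 0 ∧ (Finset.univ.filter (fun t => c t ≠ 0)).card ≤ 4 := by
  have hqm : q ^ 2 ≤ q ^ m := Nat.pow_le_pow_right (by omega) hm
  have hcard : Fintype.card (E × E) < Fintype.card ((Σ t : Fin n, Fin t) × Fˣ × Fˣ) := by
    rw [Fintype.card_prod, Fintype.card_prod, Fintype.card_prod, Fintype.card_sigma, hE,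
      Fintype.card_units, ← hq]
    simp only [Fintype.card_fin]
    rw [Fin.sum_univ_eq_sum_range (fun i => i)]
    have h2 := Finset.sum_range_id_mul_two n
    set S := ∑ i ∈ Finset.range n, i
    have hn1 : 1 ≤ n := by
      rcases Nat.eq_zero_or_pos n with h | h
      · subst h; nlinarith [Nat.sub_add_cancel (show 1 ≤ q ^ m by nlinarith)]
      · exact h
    obtain ⟨k, rfl⟩ : ∃ k, n = k + 1 := ⟨n - 1, by omega⟩
    have hQ : q ^ m = (k + 1) * r + 1 := by
      have : 1 ≤ q ^ m := by nlinarith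
      omega
    rw [hQ] at hqm ⊢
    subst hqr
    simp only [Nat.add_sub_cancel] at h2 ⊢
    have h3 : S * (2 * r * (2 * r)) = 2 * r * r * ((k + 1) * k) := by rw [← h2]; ring
    rw [h3]
    have h4 : 4 * r + 4 ≤ k + 1 := by nlinarith
    have h5 : (k+1) * r * (r * (4 * r + 3)) ≤ (k + 1) * r * (r * k) :=
      Nat.mul_le_mul_left _ (Nat.mul_le_mul_left _ (by omega))
    have h6 : r * (k+1) ≤ 2 * (r * k) := by nlinarith
    have h7 : (k+1) * r * (r * (k + 1)) ≤ (k+1)*r*(r*k) + r * r * (k+1) := by nlinarith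
    nlinarith
  obtain ⟨x, y, hxy, hf⟩ := Fintype.exists_ne_map_eq_of_card_lt (fun x => f (wtwo n x)) hcard
  refine ⟨wtwo n x - wtwo n y, by rw [map_sub, sub_eq_zero]; exact hf,
    sub_ne_zero.2 fun h => hxy (wtwo_inj n h), ?_⟩
  have hx := x.1.2.2
  have hy := y.1.2.2
  refine (Finset.card_le_card (t := {x.1.1, ⟨x.1.2, by omega⟩, y.1.1, ⟨y.1.2, by omega⟩}) ?_).trans
    Finset.card_le_four
  intro i hi
  simp only [Finset.mem_filter, Finset.mem_univ, true_and, Pi.sub_apply, wtwo] at hi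
  simp only [Finset.mem_insert, Finset.mem_singleton, Fin.ext_iff] at hi ⊢
  by_contra hcon
  push Not at hcon
  simp [hcon.1, hcon.2.1, hcon.2.2.1, hcon.2.2.2] at hi

theorem stmt_14 {F E : Type*} [Field F] [Fintype F] [DecidableEq F] [Field E] [Fintype E]
    [Algebra F E]
    (q m r : ℕ) (hq : q = Fintype.card F) (hqpp : IsPrimePow q) (hodd : Odd q)
    (hE : Fintype.card E = q ^ m) (hm : 2 ≤ m) (hrdef : r = (q - 1) / 2) (hr : 1 < r)
    (β : E) (hβ : orderOf β = q ^ m - 1) :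
    Module.finrank F ↥(constaCode (F := F) β
        ((Finset.range (q ^ m - 1)).filter
          (fun i => ((Nat.digits q i).filter (· ≠ 0)).length = 1 ∧ i % r = 1))
        ((q ^ m - 1) / r))
      = (q ^ m - 1) / r - 2 * m ∧
    (∀ c ∈ constaCode (F := F) β
        ((Finset.range (q ^ m - 1)).filter
          (fun i => ((Nat.digits q i).filter (· ≠ 0)).length = 1 ∧ i % r = 1))
        ((q ^ m - 1) / r),
      c ≠ 0 → 4 ≤ (Finset.univ.filter (fun t => c t ≠ 0)).card) ∧
    (∃ c ∈ constaCode (F := F) β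
        ((Finset.range (q ^ m - 1)).filter
          (fun i => ((Nat.digits q i).filter (· ≠ 0)).length = 1 ∧ i % r = 1))
        ((q ^ m - 1) / r),
      c ≠ 0 ∧ (Finset.univ.filter (fun t => c t ≠ 0)).card = 4) := by
  have hq5 : q = 2 * r + 1 := by
    obtain ⟨k, hk⟩ := hodd
    omega
  have hqm : q ^ 2 ≤ q ^ m := Nat.pow_le_pow_right (by omega) hm
  have hq3 : 3 * q ≤ q ^ 2 := by nlinarith
  have hdvd : r ∣ q ^ m - 1 := by
    have h1 : q - 1 ∣ q ^ m - 1 := by simpa using Nat.sub_dvd_pow_sub_pow q 1 m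
    exact (Dvd.intro_left 2 (by omega)).trans h1
  have hn : (q ^ m - 1) / r * r = q ^ m - 1 := Nat.div_mul_cancel hdvd
  set n := (q ^ m - 1) / r with hndef
  have hb0 : β ≠ 0 := by
    rintro rfl
    have h1 : (0 : E) ^ orderOf (0 : E) = 1 := pow_orderOf_eq_one _
    rw [hβ, zero_pow (by omega)] at h1
    exact zero_ne_one h1
  have hmem := fun c => code_mem (F := F) q m r n hq hq5 hm hr β c
  have hker : constaCode (F := F) β
        ((Finset.range (q ^ m - 1)).filter
          (fun i => ((Nat.digits q i).filter (· ≠ 0)).length = 1 ∧ i % r = 1)) n =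
      LinearMap.ker ((evl F n β).prod (evl F n (β ^ (r + 1)))) := by
    ext c
    rw [hmem, LinearMap.ker_prod, Submodule.mem_inf, LinearMap.mem_ker, LinearMap.mem_ker]
  have hlow : ∀ c ∈ constaCode (F := F) β
        ((Finset.range (q ^ m - 1)).filter
          (fun i => ((Nat.digits q i).filter (· ≠ 0)).length = 1 ∧ i % r = 1)) n,
      c ≠ 0 → 4 ≤ (Finset.univ.filter (fun t => c t ≠ 0)).card := by
    intro c hc hc0
    obtain ⟨h1, h2⟩ := (hmem c).1 hc
    exact h_low q r n hq hq5 β (by rw [hβ, hn]) hr hb0 c hc0 h1 h2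
  refine ⟨?_, hlow, ?_⟩
  · rw [hker]
    have h1 := LinearMap.finrank_range_add_finrank_ker
      ((evl F n β).prod (evl F n (β ^ (r + 1))))
    rw [LinearMap.range_eq_top.2 (h_surj q m r n hq hq5 hm hr hE hn β hβ hb0), finrank_top,
      Module.finrank_prod, Module.finrank_fin_fun] at h1
    have hm' : Module.finrank F E = m := by
      have h := Module.card_eq_pow_finrank (K := F) (V := E)
      rw [hE, ← hq] at h
      exact (Nat.pow_right_injective (by omega) h).symm
    omega
  · obtain ⟨c, hc, hc0, hc4⟩ := h_ex q m r n hq hq5 hm hr hE hn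
      ((evl F n β).prod (evl F n (β ^ (r + 1))))
    have hcm := hker ▸ LinearMap.mem_ker.2 hc
    exact ⟨c, hcm, hc0, le_antisymm hc4 (hlow c hcm hc0)⟩
end

section
/- Let q ≥ 3 be a prime power, m ≥ 2, and N = q^m - 1. The number of integers i with 0 ≤ i ≤ N-1 and base-q digit sum wt_q(i) ∈ {1, q} equals binom(m + q - 1, q). Consequently, the constacyclic code C(q, m, q-1, (q-1)(m-3)+q-2) (for m ≥ 3) has dimension (q^m-1)/(q-1) - binom(m+q-1, q). -/
theorem ds_add (q : ℕ) (hq : 1 < q) (a b : ℕ) (ha : a < q) :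
    (Nat.digits q (a + q * b)).sum = a + (Nat.digits q b).sum := by
  by_cases h : a ≠ 0 ∨ b ≠ 0
  · rw [Nat.digits_add q hq a b ha h]; simp
  · push Not at h
    obtain ⟨rfl, rfl⟩ := h
    simp

theorem ds_top (q : ℕ) (hq : 1 < q) (a : ℕ) (ha : a < q) (k : ℕ) :
    ∀ b < q ^ k, (Nat.digits q (b + a * q ^ k)).sum = a + (Nat.digits q b).sum := by
  induction k with
  | zero =>
    intro b hb
    have : b = 0 := by simpa using hb
    subst this
    have := ds_add q hq a 0 ha
    simpa using this
  | succ k ih =>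
    intro b hb
    have hr : b % q < q := Nat.mod_lt _ (by omega)
    have hb' : b / q < q ^ k := by
      apply Nat.div_lt_of_lt_mul
      rw [pow_succ] at hb; linarith
    have e : b + a * q ^ (k+1) = b % q + q * (b / q + a * q ^ k) := by
      conv_lhs => rw [← Nat.mod_add_div b q]
      ring
    rw [e, ds_add q hq _ _ hr, ih _ hb']
    conv_rhs => rw [← Nat.mod_add_div b q]
    rw [ds_add q hq _ _ hr]
    ring

theorem ds_last (q : ℕ) (hq : 1 < q) (m : ℕ) :
    (Nat.digits q (q ^ m - 1)).sum = m * (q - 1) := by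
  induction m with
  | zero => simp
  | succ m ih =>
    have h1 : 1 ≤ q ^ m := Nat.one_le_pow _ _ (by omega)
    have e : q ^ (m+1) - 1 = (q - 1) + q * (q ^ m - 1) := by
      obtain ⟨c, hc⟩ := Nat.exists_eq_add_of_le h1
      obtain ⟨d, rfl⟩ := Nat.exists_eq_add_of_le hq.le
      rw [pow_succ, hc]
      simp only [Nat.add_sub_cancel_left]
      rw [Nat.sub_eq_iff_eq_add (by nlinarith)]
      ring
    rw [e, ds_add q hq _ _ (by omega), ih]
    ring

def dcnt (q m s : ℕ) : ℕ :=
  ((Finset.range (q ^ m)).filter (fun i => (Nat.digits q i).sum = s)).card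

theorem dcnt_zero (q s : ℕ) : dcnt q 0 s = if s = 0 then 1 else 0 := by
  unfold dcnt
  by_cases h : s = 0
  · subst h; simp [Finset.filter_singleton]
  · have : ¬ (0 = s) := fun h' => h h'.symm
    simp [Finset.filter_singleton, h, this]

theorem dcnt_succ (q : ℕ) (hq : 1 < q) (m s : ℕ) :
    dcnt q (m+1) s = ∑ a ∈ Finset.range q, if a ≤ s then dcnt q m (s - a) else 0 := by
  have hmaps : ∀ i ∈ ((Finset.range (q ^ (m+1))).filter (fun i => (Nat.digits q i).sum = s)),
      i % q ∈ Finset.range q := fun i _ => Finset.mem_range.2 (Nat.mod_lt _ (by omega))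
  unfold dcnt
  rw [Finset.card_eq_sum_card_fiberwise hmaps]
  apply Finset.sum_congr rfl
  intro a ha
  have ha : a < q := by simpa using ha
  split_ifs with has
  · symm
    apply Finset.card_bij (fun b _ => a + q * b)
    · intro b hb
      simp only [Finset.mem_filter, Finset.mem_range] at hb ⊢
      refine ⟨⟨?_, ?_⟩, ?_⟩
      · rw [pow_succ]; nlinarith
      · rw [ds_add q hq _ _ ha, hb.2]; omega
      · rw [Nat.add_mul_mod_self_left, Nat.mod_eq_of_lt ha]
    · intro b _ c _ h
      have : q * b = q * c := by omega
      exact Nat.eq_of_mul_eq_mul_left (by omega) this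
    · intro i hi
      simp only [Finset.mem_filter, Finset.mem_range] at hi
      obtain ⟨⟨h1, h2⟩, h3⟩ := hi
      have e := Nat.mod_add_div i q
      rw [h3] at e
      refine ⟨i / q, ?_, e⟩
      simp only [Finset.mem_filter, Finset.mem_range]
      rw [← e, ds_add q hq _ _ ha] at h2
      refine ⟨?_, by omega⟩
      apply Nat.div_lt_of_lt_mul
      rw [pow_succ] at h1; linarith
  · rw [Finset.card_eq_zero, Finset.filter_eq_empty_iff]
    intro i hi h3
    simp only [Finset.mem_filter, Finset.mem_range] at hi
    obtain ⟨h1, h2⟩ := hi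
    have e := Nat.mod_add_div i q
    rw [h3] at e
    rw [← e, ds_add q hq _ _ ha] at h2
    omega

theorem dcnt_succ_lt (q : ℕ) (hq : 1 < q) (m s : ℕ) (hs : s < q) :
    dcnt q (m+1) s = ∑ t ∈ Finset.range (s+1), dcnt q m t := by
  rw [dcnt_succ q hq, ← Finset.sum_range_reflect (fun t => dcnt q m t) (s+1), ← Finset.sum_filter]
  apply Finset.sum_congr
  · ext x; simp; omega
  · intro x _; congr 1

theorem dcnt_succ_q (q : ℕ) (hq : 1 < q) (m : ℕ) :
    dcnt q (m+1) q + dcnt q m 0 = dcnt q (m+1) (q-1) + dcnt q m q := by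
  have h1 : dcnt q (m+1) q + dcnt q m 0 = ∑ t ∈ Finset.range (q+1), dcnt q m t := by
    rw [dcnt_succ q hq, ← Finset.sum_range_reflect (fun t => dcnt q m t) (q+1),
      Finset.sum_range_succ]
    congr 1
    · apply Finset.sum_congr rfl
      intro x hx
      have : x < q := by simpa using hx
      rw [if_pos this.le]; rfl
    · simp
  rw [h1, dcnt_succ_lt q hq m (q-1) (by omega), Finset.sum_range_succ]
  congr 3; omega

theorem hockey (m s : ℕ) : ∑ t ∈ Finset.range (s+1), (m + t - 1).choose t = (m + s).choose s := by
  induction s with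
  | zero => simp
  | succ s ih =>
    rw [Finset.sum_range_succ, ih]
    rw [show m + (s+1) - 1 = m + s by omega, ← add_assoc, Nat.choose_succ_succ]

theorem dcnt_lt (q : ℕ) (hq : 1 < q) (m : ℕ) : ∀ s < q, dcnt q m s = (m + s - 1).choose s := by
  induction m with
  | zero =>
    intro s hs
    rw [dcnt_zero]
    split_ifs with h
    · subst h; simp
    · symm; apply Nat.choose_eq_zero_of_lt; omega
  | succ m ih =>
    intro s hs
    rw [dcnt_succ_lt q hq m s hs]
    rw [show m + 1 + s - 1 = m + s by omega, ← hockey]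
    apply Finset.sum_congr rfl
    intro t ht
    have : t < s + 1 := by simpa using ht
    exact ih t (by omega)

theorem dcnt_q (q : ℕ) (hq : 1 < q) (m : ℕ) : dcnt q m q + m = (m + q - 1).choose q := by
  induction m with
  | zero =>
    rw [dcnt_zero, if_neg (by omega), Nat.choose_eq_zero_of_lt (by omega)]
  | succ m ih =>
    have h := dcnt_succ_q q hq m
    rw [dcnt_lt q hq (m+1) (q-1) (by omega), dcnt_lt q hq m 0 (by omega)] at h
    obtain ⟨k, rfl⟩ : ∃ k, q = k + 1 := ⟨q - 1, by omega⟩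
    rw [show m + 1 + (k+1) - 1 = (m + k) + 1 by omega, Nat.choose_succ_succ]
    rw [show m + (k+1) - 1 = m + k by omega] at ih
    simp only [Nat.add_sub_cancel, Nat.choose_zero_right] at h
    rw [show m + 1 + k - 1 = m + k by omega] at h
    simp only [Nat.succ_eq_add_one]
    omega

theorem count_main (q m : ℕ) (hq : 3 ≤ q) (hm : 2 ≤ m) :
    ((Finset.range (q ^ m - 1)).filter
        (fun i => (Nat.digits q i).sum = 1 ∨ (Nat.digits q i).sum = q)).card
      = (m + q - 1).choose q := by
  have h1 : (Finset.range (q ^ m - 1)).filter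
        (fun i => (Nat.digits q i).sum = 1 ∨ (Nat.digits q i).sum = q)
      = (Finset.range (q ^ m)).filter
        (fun i => (Nat.digits q i).sum = 1 ∨ (Nat.digits q i).sum = q) := by
    have hp : q ^ m = (q ^ m - 1) + 1 := by
      have : 1 ≤ q ^ m := Nat.one_le_pow _ _ (by omega)
      omega
    conv_rhs => rw [hp]
    rw [Finset.range_add_one, Finset.filter_insert, if_neg]
    rw [ds_last q (by omega)]
    obtain ⟨k, rfl⟩ : ∃ k, q = k + 1 := ⟨q - 1, by omega⟩
    simp only [Nat.add_sub_cancel]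
    have : 2 * k ≤ m * k := Nat.mul_le_mul_right _ hm
    omega
  rw [h1, Finset.filter_or, Finset.card_union_of_disjoint]
  · have := dcnt_q q (by omega) m
    have h2 := dcnt_lt q (by omega) m 1 (by omega)
    simp only [Nat.add_sub_cancel, Nat.choose_one_right] at h2
    unfold dcnt at this h2
    omega
  · rw [Finset.disjoint_filter]
    intro i _ h h'
    omega

theorem shift_lem (q m i : ℕ) (hq : 3 ≤ q) (hm : 1 ≤ m) (hi : i < q ^ m - 1) :
    ∃ j a, j < q ^ m - 1 ∧ (Nat.digits q j).sum = (Nat.digits q i).sum ∧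
      i * q = (q ^ m - 1) * a + j := by
  obtain ⟨k, rfl⟩ : ∃ k, m = k + 1 := ⟨m - 1, by omega⟩
  have hpos : 0 < q ^ k := Nat.pos_of_ne_zero (by positivity)
  have ha : i / q ^ k < q := by
    apply Nat.div_lt_of_lt_mul
    rw [pow_succ] at hi; omega
  have hb : i % q ^ k < q ^ k := Nat.mod_lt _ hpos
  have e := Nat.mod_add_div i (q ^ k)
  have e2 : i * q = (q ^ (k+1) - 1) * (i / q ^ k) + (i / q ^ k + q * (i % q ^ k)) := by
    have h1 : 1 ≤ q ^ (k+1) := Nat.one_le_pow _ _ (by omega)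
    zify [h1]
    zify at e
    conv_lhs => rw [← e]
    ring
  refine ⟨i / q ^ k + q * (i % q ^ k), i / q ^ k, ?_, ?_, e2⟩
  · by_contra hcon
    push Not at hcon
    set a := i / q ^ k
    set b := i % q ^ k
    rw [pow_succ] at hcon hi
    have hb1 : b + 1 = q ^ k := by
      by_contra hne
      have : b + 2 ≤ q ^ k := by omega
      nlinarith [Nat.sub_add_cancel (show 1 ≤ q ^ k * q by nlinarith)]
    have ha1 : a + 1 = q := by
      have : q * (b + 1) = q ^ k * q := by rw [hb1]; ring
      rw [mul_add] at this
      omega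
    have : q ^ k * q = q ^ k * a + q ^ k := by
      calc q ^ k * q = q ^ k * (a + 1) := by rw [ha1]
        _ = _ := by ring
    omega
  · rw [ds_add q (by omega) _ _ ha]
    conv_rhs => rw [← e, mul_comm (q ^ k)]
    rw [ds_top q (by omega) _ ha k _ hb]

open Polynomial in
theorem mem_range_of_pow {F E : Type*} [Field F] [Fintype F] [Field E]
    [Algebra F E] (x : E) (hx : x ^ Fintype.card F = x) : x ∈ Set.range (algebraMap F E) := by
  classical
  have hq : 1 < Fintype.card F := Fintype.one_lt_card
  have hne : (X ^ Fintype.card F - X : E[X]) ≠ 0 := FiniteField.X_pow_card_sub_X_ne_zero E hq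
  have hsub : (Finset.univ.image (algebraMap F E)) ⊆
      (X ^ Fintype.card F - X : E[X]).roots.toFinset := by
    intro y hy
    obtain ⟨a, _, rfl⟩ := Finset.mem_image.1 hy
    rw [Multiset.mem_toFinset, mem_roots hne]
    simp [← map_pow, FiniteField.pow_card]
  have heq := Finset.eq_of_subset_of_card_le hsub (by
    rw [Finset.card_image_of_injective _ (algebraMap F E).injective, Finset.card_univ]
    refine (Multiset.toFinset_card_le _).trans ((card_roots' _).trans ?_)
    rw [FiniteField.X_pow_card_sub_X_natDegree_eq E hq])
  have hx' : x ∈ (X ^ Fintype.card F - X : E[X]).roots.toFinset := by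
    rw [Multiset.mem_toFinset, mem_roots hne]
    simp [hx]
  rw [← heq] at hx'
  obtain ⟨a, _, ha⟩ := Finset.mem_image.1 hx'
  exact ⟨a, ha⟩

open Polynomial in
theorem gen_exists {F E : Type*} [Field F] [Fintype F] [Field E] [DecidableEq E]
    [Algebra F E] (S : Finset E) (hS : ∀ x ∈ S, x ^ Fintype.card F ∈ S) :
    ∃ g : F[X], g.Monic ∧ g.natDegree = S.card ∧
      g.map (algebraMap F E) = ∏ x ∈ S, (X - C x) := by
  set G : E[X] := ∏ x ∈ S, (X - C x) with hG
  have hmon : G.Monic := monic_prod_X_sub_C _ _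
  let φ := (FiniteField.frobeniusAlgHom F E)
  have hφ : ∀ x, φ x = x ^ Fintype.card F := fun x => rfl
  have hinj : Function.Injective φ := φ.toRingHom.injective
  have himg : S.image φ = S := by
    apply Finset.eq_of_subset_of_card_le
    · intro y hy
      obtain ⟨x, hx, rfl⟩ := Finset.mem_image.1 hy
      rw [hφ]; exact hS x hx
    · rw [Finset.card_image_of_injective _ hinj]
  have hmap : G.map φ.toRingHom = G := by
    rw [hG, Polynomial.map_prod]
    conv_rhs => rw [← himg]
    rw [Finset.prod_image (fun a _ b _ h => hinj h)]
    apply Finset.prod_congr rfl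
    intro x _
    simp
  have hl : G ∈ lifts (algebraMap F E) := by
    rw [lifts_iff_coeff_lifts]
    intro n
    apply mem_range_of_pow
    have := congrArg (fun p => p.coeff n) hmap
    simp only [coeff_map] at this
    rw [← hφ]; exact this
  obtain ⟨g, hg, hd, hgm⟩ := lifts_and_degree_eq_and_monic hl hmon
  refine ⟨g, hgm, ?_, hg⟩
  rw [natDegree_eq_of_degree_eq hd, hG, natDegree_finsetProd_X_sub_C_eq_card]

open Polynomial in
theorem code_finrank {F E : Type*} [Field F] [Fintype F] [Field E]
    [Algebra F E] (β : E) (D : Finset ℕ) (n : ℕ)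
    (hinj : Set.InjOn (fun i => β ^ i) (D : Set ℕ))
    (hD : ∀ i ∈ D, ∃ j ∈ D, (β ^ i) ^ Fintype.card F = β ^ j) :
    Module.finrank F ↥(constaCode (F := F) β D n) = n - D.card := by
  classical
  obtain ⟨g, hgm, hgd, hg⟩ := gen_exists (F := F) (D.image (fun i => β ^ i)) (by
    intro x hx
    obtain ⟨i, hi, rfl⟩ := Finset.mem_image.1 hx
    obtain ⟨j, hj, h⟩ := hD i hi
    exact Finset.mem_image.2 ⟨j, hj, h.symm⟩)
  rw [Finset.card_image_of_injOn hinj] at hgd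
  have hmem : ∀ p : degreeLT F n, degreeLTEquiv F n p ∈ constaCode (F := F) β D n ↔ g ∣ p.1 := by
    intro p
    have h1 : degreeLTEquiv F n p ∈ constaCode (F := F) β D n ↔
        ∀ i ∈ D, aeval (β ^ i) p.1 = 0 := by
      unfold constaCode
      simp only [Submodule.mem_iInf, LinearMap.mem_ker]
      refine forall₂_congr fun i _ => ?_
      have : aeval (β ^ i) p.1 = ∑ t : Fin n, (β ^ (i * (t : ℕ))) *
          algebraMap F E (degreeLTEquiv F n p t) := by
        conv_lhs => rw [← (degreeLTEquiv F n).symm_apply_apply p]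
        change aeval (β ^ i) (∑ t : Fin n, monomial t (degreeLTEquiv F n p t)) = _
        rw [map_sum]
        refine Finset.sum_congr rfl fun t _ => ?_
        rw [aeval_monomial, pow_mul, mul_comm]
      rw [this]
      simp
    rw [h1, ← map_dvd_map' (algebraMap F E), hg]
    constructor
    · intro h
      refine Finset.prod_dvd_of_coprime ?_ ?_
      · intro a _ b _ hab
        exact pairwise_coprime_X_sub_C Function.injective_id hab
      · intro x hx
        obtain ⟨i, hi, rfl⟩ := Finset.mem_image.1 hx
        rw [dvd_iff_isRoot, IsRoot.def, eval_map_algebraMap]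
        exact h i hi
    · intro h i hi
      have h2 := (Finset.dvd_prod_of_mem (fun x : E => X - C x)
        (Finset.mem_image_of_mem (fun i => β ^ i) hi)).trans h
      rw [dvd_iff_isRoot, IsRoot.def, eval_map_algebraMap] at h2
      exact h2
  have hdeg : ∀ p : F[X], g * p ∈ degreeLT F n ↔ p ∈ degreeLT F (n - D.card) := by
    intro p
    by_cases hp : p = 0
    · subst hp; simp
    · rw [mem_degreeLT, mem_degreeLT, ← natDegree_lt_iff_degree_lt (mul_ne_zero hgm.ne_zero hp),
        ← natDegree_lt_iff_degree_lt hp, natDegree_mul hgm.ne_zero hp, hgd]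
      omega
  let μ : degreeLT F (n - D.card) →ₗ[F] degreeLT F n :=
    ((LinearMap.mulLeft F g).comp (degreeLT F (n - D.card)).subtype).codRestrict _
      (fun p => (hdeg p.1).2 p.2)
  have hμ : ∀ p, (μ p : F[X]) = g * p.1 := fun p => rfl
  let φ := (degreeLTEquiv F n).toLinearMap.comp μ
  have hφ : ∀ p, φ p = degreeLTEquiv F n (μ p) := fun p => rfl
  have hφinj : Function.Injective φ := by
    intro a b h
    have h := (degreeLTEquiv F n).injective h
    have h := congrArg Subtype.val h
    rw [hμ, hμ] at h
    exact Subtype.ext (mul_left_cancel₀ hgm.ne_zero h)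
  have hr : LinearMap.range φ = constaCode (F := F) β D n := by
    ext c
    constructor
    · rintro ⟨p, rfl⟩
      rw [hφ, hmem, hμ]
      exact dvd_mul_right _ _
    · intro hc
      obtain ⟨P, rfl⟩ := (degreeLTEquiv F n).surjective c
      rw [hmem] at hc
      obtain ⟨r, hr⟩ := hc
      have : r ∈ degreeLT F (n - D.card) := by
        rw [← hdeg, ← hr]; exact P.2
      refine ⟨⟨r, this⟩, ?_⟩
      rw [hφ]
      congr 1
      apply Subtype.ext
      rw [hμ, hr]
  rw [← hr, LinearMap.finrank_range_of_inj hφinj, (degreeLTEquiv F _).finrank_eq]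
  simp

theorem stmt_17 {F E : Type*} [Field F] [Fintype F] [DecidableEq F] [Field E] [Fintype E]
    [Algebra F E]
    (q m : ℕ) (hq : q = Fintype.card F) (hq3 : 3 ≤ q) (hqpp : IsPrimePow q)
    (hE : Fintype.card E = q ^ m) (hm : 2 ≤ m)
    (β : E) (hβ : orderOf β = q ^ m - 1) :
    ((Finset.range (q ^ m - 1)).filter
        (fun i => (Nat.digits q i).sum = 1 ∨ (Nat.digits q i).sum = q)).card
      = (m + q - 1).choose q ∧
    (3 ≤ m →
      Module.finrank F ↥(constaCode (F := F) β
          ((Finset.range (q ^ m - 1)).filter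
            (fun i => (Nat.digits q i).sum < (q - 1) * m - ((q - 1) * (m - 3) + q - 2) ∧
              (Nat.digits q i).sum % (q - 1) = 1))
          ((q ^ m - 1) / (q - 1)))
        = (q ^ m - 1) / (q - 1) - (m + q - 1).choose q) := by
  refine ⟨count_main q m hq3 hm, fun hm3 => ?_⟩
  have hD : (Finset.range (q ^ m - 1)).filter
            (fun i => (Nat.digits q i).sum < (q - 1) * m - ((q - 1) * (m - 3) + q - 2) ∧
              (Nat.digits q i).sum % (q - 1) = 1) =
      (Finset.range (q ^ m - 1)).filter
        (fun i => (Nat.digits q i).sum = 1 ∨ (Nat.digits q i).sum = q) := by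
    apply Finset.filter_congr
    intro i _
    generalize (Nat.digits q i).sum = s
    have hb : (q - 1) * m - ((q - 1) * (m - 3) + q - 2) = 2 * (q - 1) + 1 := by
      obtain ⟨k, rfl⟩ : ∃ k, m = k + 3 := ⟨m - 3, by omega⟩
      obtain ⟨r, rfl⟩ : ∃ r, q = r + 1 := ⟨q - 1, by omega⟩
      simp only [Nat.add_sub_cancel, mul_add]
      omega
    rw [hb]
    clear hb hE hβ hq hqpp
    obtain ⟨r, rfl⟩ : ∃ r, q = r + 1 := ⟨q - 1, by omega⟩
    simp only [Nat.add_sub_cancel]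
    constructor
    · rintro ⟨h1, h2⟩
      have e := Nat.mod_add_div s r
      rw [h2] at e
      have : s / r < 2 := by
        by_contra hc
        have : r * 2 ≤ r * (s / r) := Nat.mul_le_mul_left _ (by omega)
        omega
      generalize s / r = w at e this
      have h01 : w = 0 ∨ w = 1 := by omega
      rcases h01 with h | h <;> rw [h] at e <;> omega
    · rintro (rfl | rfl)
      · exact ⟨by omega, Nat.mod_eq_of_lt (by omega)⟩
      · refine ⟨by omega, ?_⟩
        rw [Nat.add_mod_left, Nat.mod_eq_of_lt (by omega)]
  rw [hD, code_finrank, count_main q m hq3 hm]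
  · intro i hi j hj h
    simp only [Finset.coe_filter, Finset.mem_range, Set.mem_ofPred_eq] at hi hj
    exact pow_injOn_Iio_orderOf (by simpa [hβ] using hi.1) (by simpa [hβ] using hj.1) h
  · intro i hi
    simp only [Finset.mem_filter, Finset.mem_range] at hi
    obtain ⟨j, a, hj, hs, e⟩ := shift_lem q m i hq3 (by omega) hi.1
    refine ⟨j, ?_, ?_⟩
    · simp only [Finset.mem_filter, Finset.mem_range]
      exact ⟨hj, by rw [hs]; exact hi.2⟩
    · rw [← hq, ← pow_mul, e, pow_add, pow_mul, ← hβ, pow_orderOf_eq_one, one_pow, one_mul]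
end
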